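/- Let G be a minimal counterexample. Then no vertex of U has degree 1 in G. -/

import Mathlib

open SimpleGraph

noncomputable def edgeCount {V : Type*} (G : SimpleGraph V) : ℕ := Nat.card G.edgeSet

noncomputable def deg {V : Type*} (G : SimpleGraph V) (v : V) : ℕ := Nat.card (G.neighborSet v)

def TwoIndependent {V : Type*} (G : SimpleGraph V) (S : Set V) : Prop :=
  ∀ u ∈ S, ∀ v ∈ S, u ≠ v → ¬ G.Adj u v ∧ ∀ w, ¬ (G.Adj u w ∧ G.Adj w v)

def IsIFPartition {V : Type*} (G : SimpleGraph V) (A B : Set V) : Prop :=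
  A ∪ B = Set.univ ∧ Disjoint A B ∧ TwoIndependent G A ∧ (G.induce B).IsAcyclic

def IsAssignment {V : Type*} (I F U : Set V) : Prop :=
  I ∪ F ∪ U = Set.univ ∧ Disjoint I F ∧ Disjoint I U ∧ Disjoint F U

noncomputable def rho {V : Type*} (G : SimpleGraph V) (I F U : Set V) (H : G.Subgraph) : ℤ :=
  (H.verts ∩ I).ncard + 4 * (H.verts ∩ F).ncard + 5 * (H.verts ∩ U).ncard
    - 4 * Nat.card H.edgeSet

noncomputable def rhoSet {V : Type*} (G : SimpleGraph V) (I F U : Set V) (S : Set V) : ℤ :=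
  (S ∩ I).ncard + 4 * (S ∩ F).ncard + 5 * (S ∩ U).ncard - 4 * edgeCount (G.induce S)

def IsCounterexample {V : Type*} [Fintype V] (G : SimpleGraph V) (I F U : Set V) : Prop :=
  IsAssignment I F U ∧
  (∀ H : G.Subgraph, H.verts.Nonempty → 0 < rho G I F U H) ∧
  ¬ ∃ A B : Set V, IsIFPartition G A B ∧ I ⊆ A ∧ F ⊆ B

def IsMinCounterexample {V : Type*} [Fintype V] (G : SimpleGraph V) (I F U : Set V) : Prop :=
  IsCounterexample G I F U ∧
  ∀ (n : ℕ) (G' : SimpleGraph (Fin n)) (I' F' U' : Set (Fin n)),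
    IsCounterexample G' I' F' U' →
    Fintype.card V + edgeCount G ≤ n + edgeCount G'

def IsThread {V : Type*} (G : SimpleGraph V) (I F U : Set V) (p : List V) : Prop :=
  p ≠ [] ∧ p.Nodup ∧ p.Chain' G.Adj ∧ (∀ v ∈ p, v ∈ U ∧ deg G v = 2) ∧
  (∀ w, w ∉ p → (∃ a ∈ p, G.Adj a w) → 3 ≤ deg G w ∨ w ∈ I ∪ F)

def BordersThread {V : Type*} (G : SimpleGraph V) (p : List V) (w : V) : Prop :=
  w ∉ p ∧ ∃ a ∈ p, G.Adj a w

def IsStarForest {V : Type*} (H : SimpleGraph V) : Prop :=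
  H.IsAcyclic ∧ ∀ a b c d : V, H.Adj a b → H.Adj b c → H.Adj c d → a = c ∨ b = d

def IsStarColoring {V : Type*} {k : ℕ} (G : SimpleGraph V) (c : V → Fin k) : Prop :=
  (∀ u v, G.Adj u v → c u ≠ c v) ∧
  ∀ i j : Fin k, IsStarForest (G.induce {v | c v = i ∨ c v = j})

def StarColorable {V : Type*} (G : SimpleGraph V) (k : ℕ) : Prop :=
  ∃ c : V → Fin k, IsStarColoring G c

def MadLt {V : Type*} (G : SimpleGraph V) (q : ℚ) : Prop :=
  ∀ H : G.Subgraph, H.verts.Nonempty →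
    (2 * (Nat.card H.edgeSet : ℚ)) / (H.verts.ncard : ℚ) < q

theorem acyclic_of_pendant {W : Type*} (K : SimpleGraph W) (x : W)
    (hx : ∀ a b, K.Adj x a → K.Adj x b → a = b)
    (h : (K.induce {y | y ≠ x}).IsAcyclic) : K.IsAcyclic := by
  classical
  intro u c hc
  by_cases hxc : x ∈ c.support
  · have hc' := hc.rotate hxc
    exact hc'.snd_ne_penultimate (hx _ _ ((c.rotate x hxc).adj_snd hc'.not_nil)
      ((c.rotate x hxc).adj_penultimate hc'.not_nil).symm)
  · have hs : ∀ y ∈ c.support, y ∈ {y | y ≠ x} := by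
      rintro y hy rfl
      exact hxc hy
    refine h (c.induce _ hs) ?_
    refine Walk.IsCycle.of_map (f := (Embedding.induce {y | y ≠ x}).toHom) ?_
    rw [Walk.map_induce]
    exact hc

/-- (C1) In a minimal counterexample, no vertex of `U` has degree 1. -/
theorem no_one_vertex_in_U {V : Type*} [Fintype V] (G : SimpleGraph V)
    (I F U : Set V) (hmin : IsMinCounterexample G I F U) :
    ∀ v ∈ U, deg G v ≠ 1 := by
  classical
  intro v hvU hdeg
  obtain ⟨⟨⟨hcov, hIF, hIU, hFU⟩, hrho, hno⟩, hmin⟩ := hmin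
  -- the unique neighbour of `v`
  have huniq : ∀ a b, G.Adj v a → G.Adj v b → a = b := by
    intro a b ha hb
    have hss : Subsingleton (G.neighborSet v) :=
      (Nat.card_eq_one_iff_unique.mp hdeg).1
    exact congrArg Subtype.val (hss.elim ⟨a, ha⟩ ⟨b, hb⟩)
  let e := Fintype.equivFin {x : V // x ≠ v}
  let f : Fin (Fintype.card {x : V // x ≠ v}) → V := fun i => (e.symm i).1
  have hf : Function.Injective f := Subtype.val_injective.comp e.symm.injective
  have hfe : ∀ x (h : x ≠ v), f (e ⟨x, h⟩) = x := by
    intro x h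
    simp [f]
  let G' := G.comap f
  let φ : G' →g G := ⟨f, fun h => h⟩
  have hcard : Fintype.card {x : V // x ≠ v} < Fintype.card V :=
    Fintype.card_subtype_lt (x := v) (by simp)
  have hedge : edgeCount G' ≤ edgeCount G :=
    Nat.card_le_card_of_injective _ (Hom.mapEdgeSet.injective φ hf)
  have hcount : ¬ IsCounterexample G' (f ⁻¹' I) (f ⁻¹' F) (f ⁻¹' U) := by
    intro h
    have := hmin _ G' _ _ _ h
    omega
  apply hcount
  refine ⟨⟨?_, hIF.preimage f, hIU.preimage f, hFU.preimage f⟩, ?_, ?_⟩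
  · rw [← Set.preimage_union, ← Set.preimage_union, hcov, Set.preimage_univ]
  · intro H hH
    have key := hrho (H.map φ) (hH.image _)
    have hn : ∀ S : Set V, ((H.map φ).verts ∩ S).ncard = (H.verts ∩ f ⁻¹' S).ncard := by
      intro S
      rw [← Set.ncard_image_of_injective _ hf, Set.image_inter_preimage]
      rfl
    have he : Nat.card (H.map φ).edgeSet = Nat.card H.edgeSet := by
      rw [Subgraph.edgeSet_map]
      exact Nat.card_image_of_injective (Sym2.map.injective hf) _
    unfold rho at key ⊢
    rw [hn, hn, hn, he] at key
    exact key
  · rintro ⟨A', B', ⟨hAB, hdis, htwo, hac⟩, hIA, hFB⟩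
    apply hno
    let A : Set V := f '' A'
    have hvA : v ∉ A := by
      rintro ⟨i, -, hi⟩
      exact (e.symm i).2 hi
    refine ⟨A, Aᶜ, ⟨Set.union_compl_self A, disjoint_compl_right, ?_, ?_⟩, ?_, ?_⟩
    · rintro _ ⟨i, hi, rfl⟩ _ ⟨j, hj, rfl⟩ hne
      have hij : i ≠ j := fun h => hne (congrArg f h)
      obtain ⟨h1, h2⟩ := htwo i hi j hj hij
      refine ⟨h1, ?_⟩
      rintro w ⟨hw1, hw2⟩
      by_cases hw : w = v
      · subst hw
        exact hne (huniq _ _ hw1.symm hw2)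
      · apply h2 (e ⟨w, hw⟩)
        simp only [G', comap_adj, hfe]
        exact ⟨hw1, hw2⟩
    · apply acyclic_of_pendant _ (⟨v, hvA⟩ : (Aᶜ : Set V))
      · rintro ⟨a, _⟩ ⟨b, _⟩ ha hb
        exact Subtype.ext (huniq a b ha hb)
      · have hne : ∀ y : {y : (Aᶜ : Set V) | y ≠ ⟨v, hvA⟩}, y.1.1 ≠ v :=
          fun y h => y.2 (Subtype.ext h)
        have hB : ∀ y : {y : (Aᶜ : Set V) | y ≠ ⟨v, hvA⟩}, e ⟨y.1.1, hne y⟩ ∈ B' := by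
          intro y
          have h : e ⟨y.1.1, hne y⟩ ∈ A' ∪ B' := hAB ▸ Set.mem_univ _
          refine h.resolve_left fun h => y.1.2 ⟨_, h, hfe _ _⟩
        refine hac.comap ⟨fun y => ⟨e ⟨y.1.1, hne y⟩, hB y⟩, ?_⟩ ?_
        · intro y z hyz
          simp only [G', comap_adj, Function.Embedding.subtype_apply, hfe]
          exact hyz
        · intro y z hyz
          have h1 := e.injective (congrArg Subtype.val hyz)
          exact Subtype.ext (Subtype.ext (Subtype.mk.inj h1))
    · intro x hx
      have hxv : x ≠ v := by
        rintro rfl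
        exact Set.disjoint_left.mp hIU hx hvU
      refine ⟨e ⟨x, hxv⟩, hIA ?_, hfe _ _⟩
      rw [Set.mem_preimage, hfe]
      exact hx
    · rintro _ hx ⟨i, hi, rfl⟩
      exact Set.disjoint_left.mp hdis hi (hFB hx)
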